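/- arXiv:2511.19666 — 2 statements merged into one kernel-verified Lean document; each statement's English description precedes it below -/
import Mathlib

section
/- Carbon-matching system balance with nodally varying marginal emissions rates: if energy conservation holds at every node i, i.e. ∑_j t(j,i) + g_i − l_i = 0, then the total load footprint plus total generation footprint plus total transmission footprint equals the true total emissions of the grid: C_L + C_G + C_T = ∑_i E_i · g_i, where C_L = ∑_i MER_i · l_i, C_G = ∑_i (E_i − MER_i) · g_i, and C_T = (1/2) · ∑_{j,i} ( MER_j − MER_i ) · t(j,i). -/
/-- **Carbon-matching system balance with nodally varying MERs.** A grid snapshot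
has a finite set of nodes `V`, with load `l i`, generation `g i`, generator
emission rate `E i` and marginal emissions rate `MER i` at each node, and an
antisymmetric transmission flow `t : V → V → ℝ` (`t j i` is the power flowing
from `j` to `i`). If energy conservation holds at every node,
`∑ j, t j i + g i − l i = 0`, then the total load footprint plus total
generation footprint plus total transmission footprint equals the true total
emissions:
`∑ i, MER i * l i + ∑ i, (E i − MER i) * g i
  + (1/2) * ∑ j, ∑ i, (MER j − MER i) * t j i = ∑ i, E i * g i`. -/
theorem carbon_matching_balance_varying_mer
    {V : Type*} [Fintype V] (l g E MER : V → ℝ) (t : V → V → ℝ)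
    (hanti : ∀ i j, t j i = - t i j)
    (hcons : ∀ i, (∑ j, t j i) + g i - l i = 0) :
    (∑ i, MER i * l i) + (∑ i, (E i - MER i) * g i)
        + (1 / 2) * ∑ j, ∑ i, (MER j - MER i) * t j i
      = ∑ i, E i * g i := by
  have h1 : ∑ i, MER i * l i = (∑ i, MER i * ∑ j, t j i) + ∑ i, MER i * g i := by
    rw [← Finset.sum_add_distrib]
    refine Finset.sum_congr rfl fun i _ => ?_
    have h : l i = (∑ j, t j i) + g i := by linarith [hcons i]
    rw [h]; ring
  have h2 : ∑ i, (E i - MER i) * g i = (∑ i, E i * g i) - ∑ i, MER i * g i := by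
    rw [← Finset.sum_sub_distrib]
    exact Finset.sum_congr rfl fun i _ => by ring
  have h3 : ∑ j, ∑ i, MER j * t j i = - ∑ i, MER i * ∑ j, t j i := by
    rw [← Finset.sum_neg_distrib]
    refine Finset.sum_congr rfl fun j _ => ?_
    rw [Finset.mul_sum, ← Finset.sum_neg_distrib]
    exact Finset.sum_congr rfl fun i _ => by rw [hanti i j]; ring
  have h4 : ∑ j, ∑ i, MER i * t j i = ∑ i, MER i * ∑ j, t j i := by
    rw [Finset.sum_comm]
    exact Finset.sum_congr rfl fun i _ => by rw [Finset.mul_sum]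
  have h5 : ∑ j, ∑ i, (MER j - MER i) * t j i
      = (∑ j, ∑ i, MER j * t j i) - ∑ j, ∑ i, MER i * t j i := by
    simp only [sub_mul, Finset.sum_sub_distrib]
  rw [h5, h3, h4, h1, h2]
  ring
end

section
/- Carbon-matching system balance extends over multiple time steps: if for each time step τ in a finite index set, energy conservation holds at every node (∑_j t_τ(j,i) + g_{τ,i} − l_{τ,i} = 0 for all i), then the temporal sum of all footprints equals the temporal sum of true emissions: ∑_τ ( C_{L,τ} + C_{G,τ} + C_{T,τ} ) = ∑_τ ∑_i E_{τ,i} · g_{τ,i}, where C_{L,τ} = ∑_i MER_{τ,i} · l_{τ,i}, C_{G,τ} = ∑_i (E_{τ,i} − MER_{τ,i}) · g_{τ,i}, and C_{T,τ} = (1/2) · ∑_{j,i} (MER_{τ,j} − MER_{τ,i}) · t_τ(j,i). -/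
/-- **Carbon-matching balance over multiple time steps.** A multi-period grid has
a finite set of nodes `V` and a finite set of time steps `T`; at each time `τ`
every node `i` has load `l τ i`, generation `g τ i`, emission rate `E τ i` and
marginal emissions rate `MER τ i`, and transmission at time `τ` is an
antisymmetric flow `t τ : V → V → ℝ`. If for each time step energy conservation
holds at every node (`∑ j, t τ j i + g τ i − l τ i = 0`), then the temporal sum
of all footprints equals the temporal sum of true emissions:
`∑ τ, (C_{L,τ} + C_{G,τ} + C_{T,τ}) = ∑ τ, ∑ i, E τ i * g τ i`. -/
theorem carbon_matching_balance_multi_period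
    {V : Type*} [Fintype V] {T : Type*} [Fintype T]
    (l g E MER : T → V → ℝ) (t : T → V → V → ℝ)
    (hanti : ∀ τ i j, t τ j i = - t τ i j)
    (hcons : ∀ τ i, (∑ j, t τ j i) + g τ i - l τ i = 0) :
    ∑ τ, ((∑ i, MER τ i * l τ i) + (∑ i, (E τ i - MER τ i) * g τ i)
        + (1 / 2) * ∑ j, ∑ i, (MER τ j - MER τ i) * t τ j i)
      = ∑ τ, ∑ i, E τ i * g τ i := by
  refine Finset.sum_congr rfl fun τ _ => ?_
  have hin : ∀ i, ∑ j, t τ j i = l τ i - g τ i := fun i => by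
    have := hcons τ i
    linarith
  have hout : ∀ j, ∑ i, t τ j i = -(l τ j - g τ j) := fun j => by
    rw [← hin j, ← Finset.sum_neg_distrib]
    exact Finset.sum_congr rfl fun i _ => hanti τ i j
  have hA : ∑ j, ∑ i, MER τ j * t τ j i = -∑ j, MER τ j * (l τ j - g τ j) := by
    rw [← Finset.sum_neg_distrib]
    refine Finset.sum_congr rfl fun j _ => ?_
    rw [← Finset.mul_sum, hout]
    ring
  have hB : ∑ j, ∑ i, MER τ i * t τ j i = ∑ j, MER τ j * (l τ j - g τ j) := by
    rw [Finset.sum_comm]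
    refine Finset.sum_congr rfl fun j _ => ?_
    rw [← Finset.mul_sum, hin]
  simp only [sub_mul, Finset.sum_sub_distrib, hA, hB]
  simp only [mul_sub, Finset.sum_sub_distrib]
  ring
end
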